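/- Let s and v be complex numbers with Re s > 1 and Re v > 1. Then the series Σ_{n=0}^∞ C_{n+1} Σ_{k=0}^n (−1)^k C(n,k) (k+v)^{−s} converges and Σ_{n=0}^∞ (n+v)^{−s} = (v−1)^{1−s}/(s−1) − Σ_{n=0}^∞ C_{n+1} Σ_{k=0}^n (−1)^k C(n,k) (k+v)^{−s}, where C_n are the normalized Cauchy numbers of the second kind. -/

import Mathlib

open Filter Finset intervalIntegral

/-- The normalized Cauchy numbers of the second kind
`C_n = ∫₀¹ x(x+1)(x+2)⋯(x+n−1)/n! dx`. -/
noncomputable def cauchyC (n : ℕ) : ℝ :=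
  ∫ x in (0:ℝ)..1, (∏ i ∈ Finset.range n, (x + (i : ℝ))) / (n.factorial : ℝ)

namespace CauchySeries

open MeasureTheory Set

lemma integrableOn_rpow_mul_exp_neg_mul {p b : ℝ} (hp : 0 < p) (hb : 0 < b) :
    IntegrableOn (fun t : ℝ => t ^ (p - 1) * Real.exp (-b * t)) (Ioi 0) := by
  simpa using integrableOn_rpow_mul_exp_neg_mul_rpow (p := 1) (s := p - 1) (b := b)
    (by linarith) one_pos hb

lemma norm_cpow_mul_exp_neg_mul (a r : ℂ) {t : ℝ} (ht : 0 < t) :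
    ‖(t : ℂ) ^ (a - 1) * Complex.exp (-(r * t))‖ =
      t ^ (a.re - 1) * Real.exp (-r.re * t) := by
  simp [Complex.norm_cpow_eq_rpow_re_of_pos ht, Complex.norm_exp]

lemma measurable_cpow_mul_exp_neg_mul (a r : ℂ) :
    Measurable (fun t : ℝ => (t : ℂ) ^ (a - 1) * Complex.exp (-(r * t))) := by
  fun_prop

lemma integrableOn_cpow_mul_exp_neg_mul {a r : ℂ} (ha : 0 < a.re) (hr : 0 < r.re) :
    IntegrableOn (fun t : ℝ => (t : ℂ) ^ (a - 1) * Complex.exp (-(r * t))) (Ioi 0) :=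
  (integrableOn_rpow_mul_exp_neg_mul ha hr).mono'
    (measurable_cpow_mul_exp_neg_mul a r).aestronglyMeasurable
    ((ae_restrict_mem measurableSet_Ioi).mono fun _ ht =>
      (norm_cpow_mul_exp_neg_mul a r ht).le)

lemma differentiableAt_integral_cpow_mul_exp_neg_mul {a r : ℂ} (ha : 0 < a.re)
    (hr : 0 < r.re) :
    DifferentiableAt ℂ
      (fun r : ℂ => ∫ t in Ioi (0 : ℝ), (t : ℂ) ^ (a - 1) * Complex.exp (-(r * t))) r := by
  have hs : {z : ℂ | r.re / 2 < z.re} ∈ nhds r :=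
    (isOpen_lt continuous_const Complex.continuous_re).mem_nhds
      (show r.re / 2 < r.re by linarith)
  refine (hasDerivAt_integral_of_dominated_loc_of_deriv_le
    (F' := fun z t => (t : ℂ) ^ (a - 1) * (Complex.exp (-(z * t)) * (-t)))
    (bound := fun t => t ^ ((a.re + 1) - 1) * Real.exp (-(r.re / 2) * t)) hs
    (.of_forall fun z => (measurable_cpow_mul_exp_neg_mul a z).aestronglyMeasurable)
    (integrableOn_cpow_mul_exp_neg_mul ha hr) ?_ ?_
    (integrableOn_rpow_mul_exp_neg_mul (by linarith) (by linarith)) ?_).2.differentiableAt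
  · exact Measurable.aestronglyMeasurable (by fun_prop)
  · filter_upwards [ae_restrict_mem measurableSet_Ioi] with t ht z hz
    have ht : 0 < t := ht
    rw [← mul_assoc, norm_mul, norm_cpow_mul_exp_neg_mul a z ht, norm_neg, Complex.norm_real,
      Real.norm_of_nonneg ht.le, mul_right_comm, ← Real.rpow_add_one ht.ne',
      show a.re + 1 - 1 = a.re - 1 + 1 by ring]
    have hz : r.re / 2 < z.re := hz
    gcongr
  · refine .of_forall fun t z _ => ?_
    have h : HasDerivAt (fun z : ℂ => -(z * t)) (-(t : ℂ)) z :=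
      (hasDerivAt_mul_const (t : ℂ)).fun_neg
    exact h.cexp.const_mul _

/-- Euler's integral `∫₀^∞ t^(a-1) e^(-rt) dt = r^(-a) Γ(a)` for complex `r` with `0 < Re r`. -/
lemma integral_cpow_mul_exp_neg_mul {a r : ℂ} (ha : 0 < a.re) (hr : 0 < r.re) :
    ∫ t in Ioi (0 : ℝ), (t : ℂ) ^ (a - 1) * Complex.exp (-(r * t)) =
      r ^ (-a) * Complex.Gamma a := by
  have hopen : IsOpen {z : ℂ | 0 < z.re} := isOpen_lt continuous_const Complex.continuous_re
  have hI : AnalyticOnNhd ℂ (fun r : ℂ => ∫ t in Ioi (0 : ℝ),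
      (t : ℂ) ^ (a - 1) * Complex.exp (-(r * t))) {z : ℂ | 0 < z.re} :=
    DifferentiableOn.analyticOnNhd (fun z hz =>
      (differentiableAt_integral_cpow_mul_exp_neg_mul ha hz).differentiableWithinAt) hopen
  have hG : AnalyticOnNhd ℂ (fun r : ℂ => r ^ (-a) * Complex.Gamma a) {z : ℂ | 0 < z.re} :=
    DifferentiableOn.analyticOnNhd (fun z hz =>
      ((differentiableAt_id.cpow_const (Or.inl hz)).mul_const _).differentiableWithinAt) hopen
  refine hI.eqOn_of_preconnected_of_frequently_eq hG
    (convex_halfSpace_re_gt 0).isPreconnected (z₀ := 1) (by simp) ?_ hr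
  have hlim : Tendsto (fun x : ℝ => (x : ℂ)) (nhdsWithin 1 {1}ᶜ) (nhdsWithin 1 {1}ᶜ) := by
    refine tendsto_nhdsWithin_of_tendsto_nhds_of_eventually_within _ ?_ ?_
    · exact (Complex.continuous_ofReal.tendsto' 1 1 (by simp)).mono_left nhdsWithin_le_nhds
    · filter_upwards [self_mem_nhdsWithin] with x hx
      simpa using hx
  refine hlim.frequently (Eventually.frequently ?_)
  filter_upwards [nhdsWithin_le_nhds (lt_mem_nhds (zero_lt_one' ℝ))] with x hx
  rw [Complex.integral_cpow_mul_exp_neg_mul_Ioi ha hx, one_div, Complex.inv_cpow, Complex.cpow_neg]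
  rw [Complex.arg_ofReal_of_nonneg hx.le]
  exact Real.pi_pos.ne

/-- Termwise integration of a nonnegative series dominated by `e^t / t` against the kernel
`t^(s-1) e^(-vt)`. -/
lemma hasSum_integral_of_le_exp_div {s v : ℂ} (hs : 1 < s.re) (hv : 1 < v.re)
    {f : ℕ → ℝ → ℝ} {F : ℝ → ℝ} (hf : ∀ n, Measurable (f n)) (hF : Measurable F)
    (hf0 : ∀ n t, 0 < t → 0 ≤ f n t) (hsum : ∀ t, 0 < t → HasSum (fun n => f n t) (F t))
    (hle : ∀ t, 0 < t → F t ≤ Real.exp t / t) :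
    IntegrableOn (fun t : ℝ => (t : ℂ) ^ (s - 1) * Complex.exp (-(v * t)) * F t) (Ioi 0) ∧
    HasSum (fun n => ∫ t in Ioi (0 : ℝ), (t : ℂ) ^ (s - 1) * Complex.exp (-(v * t)) * f n t)
      (∫ t in Ioi (0 : ℝ), (t : ℂ) ^ (s - 1) * Complex.exp (-(v * t)) * F t) := by
  have hnorm (t : ℝ) (ht : 0 < t) (y : ℝ) (hy : 0 ≤ y) :
      ‖(t : ℂ) ^ (s - 1) * Complex.exp (-(v * t)) * y‖ =
        t ^ (s.re - 1) * Real.exp (-v.re * t) * y := by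
    rw [norm_mul, norm_cpow_mul_exp_neg_mul s v ht, Complex.norm_real, Real.norm_of_nonneg hy]
  have hF0 (t : ℝ) (ht : 0 < t) : 0 ≤ F t := (hsum t ht).nonneg fun n => hf0 n t ht
  have hint : IntegrableOn
      (fun t : ℝ => (t : ℂ) ^ (s - 1) * Complex.exp (-(v * t)) * F t) (Ioi 0) := by
    refine (integrableOn_rpow_mul_exp_neg_mul (p := s.re - 1) (b := v.re - 1)
      (by linarith) (by linarith)).mono' (Measurable.aestronglyMeasurable (by fun_prop)) ?_
    filter_upwards [ae_restrict_mem measurableSet_Ioi] with t ht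
    have ht : 0 < t := ht
    rw [hnorm t ht _ (hF0 t ht)]
    calc t ^ (s.re - 1) * Real.exp (-v.re * t) * F t
        ≤ t ^ (s.re - 1) * Real.exp (-v.re * t) * (Real.exp t / t) := by
          gcongr
          exact hle t ht
      _ = t ^ (s.re - 1 - 1) * Real.exp (-(v.re - 1) * t) := by
          rw [Real.rpow_sub_one ht.ne' (s.re - 1),
            show -(v.re - 1) * t = -v.re * t + t by ring, Real.exp_add]
          ring
  refine ⟨hint, hasSum_integral_of_dominated_convergence
    (fun n t => ‖(t : ℂ) ^ (s - 1) * Complex.exp (-(v * t)) * f n t‖)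
    (fun n => Measurable.aestronglyMeasurable ?_) (fun n => .of_forall fun t => le_rfl) ?_ ?_ ?_⟩
  · have := hf n
    fun_prop
  · filter_upwards [ae_restrict_mem measurableSet_Ioi] with t ht
    simp_rw [hnorm t ht _ (hf0 _ t ht)]
    exact (hsum t ht).summable.mul_left _
  · refine hint.norm.congr ?_
    filter_upwards [ae_restrict_mem measurableSet_Ioi] with t ht
    simp_rw [hnorm t ht _ (hf0 _ t ht), hnorm t ht _ (hF0 t ht)]
    exact ((hsum t ht).mul_left _).tsum_eq.symm
  · filter_upwards [ae_restrict_mem measurableSet_Ioi] with t ht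
    exact (Complex.hasSum_ofReal.mpr (hsum t ht)).mul_left _

lemma ringChoose_eq_prod (x : ℝ) (n : ℕ) :
    Ring.choose (x + n - 1) n = (∏ i ∈ Finset.range n, (x + (i : ℝ))) / (n.factorial : ℝ) := by
  have h := Ring.factorial_nsmul_multichoose_eq_ascPochhammer x n
  rw [← Ring.multichoose_eq, eq_div_iff (by positivity), mul_comm, ← nsmul_eq_mul, h,
    Polynomial.ascPochhammer_smeval_eq_eval]
  clear h
  induction n with
  | zero => simp
  | succ n ih => rw [ascPochhammer_succ_eval, ih, Finset.prod_range_succ]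

lemma prod_div_factorial_nonneg {x : ℝ} (hx : 0 ≤ x) (n : ℕ) :
    0 ≤ (∏ i ∈ Finset.range n, (x + (i : ℝ))) / (n.factorial : ℝ) := by
  have := Finset.prod_nonneg (s := Finset.range n) fun i _ => add_nonneg hx i.cast_nonneg
  positivity

lemma prod_div_factorial_le_one {x : ℝ} (hx : 0 ≤ x) (hx1 : x ≤ 1) (n : ℕ) :
    (∏ i ∈ Finset.range n, (x + (i : ℝ))) / (n.factorial : ℝ) ≤ 1 := by
  rw [div_le_one (by positivity), ← Finset.prod_range_add_one_eq_factorial]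
  push_cast
  exact Finset.prod_le_prod (fun i _ => add_nonneg hx i.cast_nonneg) fun i _ => by linarith

lemma cauchyC_nonneg (n : ℕ) : 0 ≤ cauchyC n :=
  intervalIntegral.integral_nonneg zero_le_one fun _ hx => prod_div_factorial_nonneg hx.1 n

lemma hasSum_prod_div_factorial_mul_pow (x : ℝ) {z : ℝ} (hz : 0 ≤ z) (hz1 : z < 1) :
    HasSum (fun n : ℕ => (∏ i ∈ Finset.range n, (x + (i : ℝ))) / (n.factorial : ℝ) * z ^ n)
      (1 / (1 - z) ^ x) := by
  have h := (Real.one_div_one_sub_rpow_hasFPowerSeriesOnBall_zero x).hasSum (y := z)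
    (by simpa [enorm_eq_nnnorm, ← NNReal.coe_lt_coe, abs_of_nonneg hz] using hz1)
  simpa [FormalMultilinearSeries.ofScalars, ringChoose_eq_prod] using h

lemma hasSum_cauchyC_mul_pow {t : ℝ} (ht : 0 < t) :
    HasSum (fun n => cauchyC n * (1 - Real.exp (-t)) ^ n) ((Real.exp t - 1) / t) := by
  have hz : 0 ≤ 1 - Real.exp (-t) := by simpa using ht.le
  have hz1 : 1 - Real.exp (-t) < 1 := by simpa using Real.exp_pos (-t)
  have h := intervalIntegral.hasSum_integral_of_dominated_convergence (a := 0) (b := 1)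
    (μ := volume)
    (F := fun (n : ℕ) (x : ℝ) => (∏ i ∈ Finset.range n, (x + (i : ℝ))) / (n.factorial : ℝ) *
      (1 - Real.exp (-t)) ^ n)
    (f := fun x => 1 / (1 - (1 - Real.exp (-t))) ^ x)
    (fun n _ => (1 - Real.exp (-t)) ^ n)
    (fun n => Continuous.aestronglyMeasurable (by fun_prop))
    (fun n => .of_forall fun x hx => ?_)
    (.of_forall fun x _ => summable_geometric_of_lt_one hz hz1)
    intervalIntegrable_const
    (.of_forall fun x _ => hasSum_prod_div_factorial_mul_pow x hz hz1)
  · simp_rw [intervalIntegral.integral_mul_const] at h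
    convert! h using 1
    have he (x : ℝ) : 1 / (1 - (1 - Real.exp (-t))) ^ x = Real.exp (t * x) := by
      rw [sub_sub_cancel, ← Real.exp_mul, one_div, ← Real.exp_neg]
      ring_nf
    simp_rw [he]
    rw [intervalIntegral.integral_comp_mul_left _ ht.ne', integral_exp]
    simp
    ring
  · rw [uIoc_of_le zero_le_one] at hx
    have h0 := prod_div_factorial_nonneg hx.1.le n
    rw [Real.norm_of_nonneg (by positivity)]
    exact mul_le_of_le_one_left (by positivity) (prod_div_factorial_le_one hx.1.le hx.2 n)

lemma cauchyC_zero : cauchyC 0 = 1 := by simp [cauchyC]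

lemma hasSum_cauchyC_succ_mul_pow {t : ℝ} (ht : 0 < t) :
    HasSum (fun n => cauchyC (n + 1) * (1 - Real.exp (-t)) ^ n)
      (Real.exp t / t - (1 - Real.exp (-t))⁻¹) := by
  have hz : 0 < 1 - Real.exp (-t) := by simpa using ht
  have h := ((hasSum_nat_add_iff' 1).mpr (hasSum_cauchyC_mul_pow ht)).mul_right
    (1 - Real.exp (-t))⁻¹
  convert! h using 1
  · ext n
    rw [pow_succ]
    field_simp
  · have : Real.exp t - 1 = Real.exp t * (1 - Real.exp (-t)) := by
      rw [mul_sub, ← Real.exp_add]; simp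
    rw [this]
    simp only [Finset.sum_range_one, cauchyC_zero, pow_zero]
    field_simp

lemma inv_one_sub_exp_neg_le {t : ℝ} (ht : 0 < t) :
    (1 - Real.exp (-t))⁻¹ ≤ Real.exp t / t := by
  have hz : 0 < 1 - Real.exp (-t) := by simpa using ht
  rw [inv_le_comm₀ hz (by positivity), inv_div, Real.exp_neg, div_le_iff₀ (Real.exp_pos t),
    sub_mul, inv_mul_cancel₀ (Real.exp_pos t).ne']
  linarith [Real.add_one_le_exp t]

lemma natCast_add_re_pos {v : ℂ} (hv : 1 < v.re) (k : ℕ) : 0 < ((k : ℂ) + v).re := by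
  simp only [Complex.add_re, Complex.natCast_re]
  positivity

lemma integral_mul_exp_neg_nat_mul {s v : ℂ} (hs : 1 < s.re) (hv : 1 < v.re) (k : ℕ) :
    ∫ t in Ioi (0 : ℝ), (t : ℂ) ^ (s - 1) * Complex.exp (-(v * t)) *
      (Real.exp (-t) ^ k : ℝ) = ((k : ℂ) + v) ^ (-s) * Complex.Gamma s := by
  rw [← integral_cpow_mul_exp_neg_mul (zero_lt_one.trans hs) (natCast_add_re_pos hv k)]
  congr 1 with t
  push_cast
  rw [← Complex.exp_nat_mul, mul_assoc, ← Complex.exp_add]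
  ring_nf

lemma integrableOn_mul_exp_neg_nat_mul {s v : ℂ} (hs : 1 < s.re) (hv : 1 < v.re) (k : ℕ) :
    IntegrableOn (fun t : ℝ => (t : ℂ) ^ (s - 1) * Complex.exp (-(v * t)) *
      (Real.exp (-t) ^ k : ℝ)) (Ioi 0) := by
  convert! integrableOn_cpow_mul_exp_neg_mul (zero_lt_one.trans hs) (natCast_add_re_pos hv k)
    using 2 with t
  push_cast
  rw [← Complex.exp_nat_mul, mul_assoc, ← Complex.exp_add]
  ring_nf

lemma integral_mul_one_sub_exp_neg_pow {s v : ℂ} (hs : 1 < s.re) (hv : 1 < v.re) (c : ℝ) (n : ℕ) :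
    ∫ t in Ioi (0 : ℝ), (t : ℂ) ^ (s - 1) * Complex.exp (-(v * t)) *
      (c * (1 - Real.exp (-t)) ^ n : ℝ) =
    c * (∑ k ∈ Finset.range (n + 1), (-1) ^ k * (n.choose k : ℂ) * ((k : ℂ) + v) ^ (-s)) *
      Complex.Gamma s := by
  have h (t : ℝ) : (t : ℂ) ^ (s - 1) * Complex.exp (-(v * t)) *
      (c * (1 - Real.exp (-t)) ^ n : ℝ) =
      ∑ k ∈ Finset.range (n + 1), (c * ((-1) ^ k * (n.choose k : ℂ))) *
        ((t : ℂ) ^ (s - 1) * Complex.exp (-(v * t)) * (Real.exp (-t) ^ k : ℝ)) := by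
    rw [sub_eq_neg_add 1 (Real.exp (-t)), add_pow]
    push_cast
    rw [Finset.mul_sum, Finset.mul_sum]
    refine Finset.sum_congr rfl fun k _ => ?_
    rw [neg_pow]
    ring
  simp_rw [h]
  rw [integral_finsetSum _ fun k _ => (integrableOn_mul_exp_neg_nat_mul hs hv k).const_mul _]
  simp_rw [MeasureTheory.integral_const_mul, integral_mul_exp_neg_nat_mul hs hv]
  rw [Finset.mul_sum, Finset.sum_mul]
  exact Finset.sum_congr rfl fun k _ => by ring

lemma integral_mul_exp_div {s v : ℂ} (hs : 1 < s.re) (hv : 1 < v.re) :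
    ∫ t in Ioi (0 : ℝ), (t : ℂ) ^ (s - 1) * Complex.exp (-(v * t)) * (Real.exp t / t : ℝ) =
      (v - 1) ^ (1 - s) / (s - 1) * Complex.Gamma s := by
  have hs1 : s - 1 ≠ 0 := fun h => by
    have := congrArg Complex.re h
    simp at this
    linarith
  have h := integral_cpow_mul_exp_neg_mul (a := s - 1) (r := v - 1) (by simpa using hs)
    (by simpa using hv)
  have hG := Complex.Gamma_add_one (s - 1) hs1
  rw [sub_add_cancel] at hG
  rw [hG, div_mul_eq_mul_div, mul_left_comm, mul_div_cancel_left₀ _ hs1, ← neg_sub s 1, ← h]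
  refine setIntegral_congr_fun measurableSet_Ioi fun t ht => ?_
  have ht : (t : ℂ) ≠ 0 := Complex.ofReal_ne_zero.mpr (ne_of_gt ht)
  simp only [Complex.ofReal_div, Complex.ofReal_exp]
  rw [Complex.cpow_sub (s - 1) 1 ht, Complex.cpow_one,
    show -((v - 1) * (t : ℂ)) = -(v * t) + t by ring, Complex.exp_add]
  ring

end CauchySeries

open CauchySeries

/-- Series with the normalized Cauchy numbers of the second kind for the Hurwitz zeta
function: for `Re s > 1` and `Re v > 1`, the series
`Σ_{n=0}^∞ C_{n+1} Σ_{k=0}^n (−1)^k C(n,k) (k+v)^{−s}` converges and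
`Σ_{n=0}^∞ (n+v)^{−s} = (v−1)^{1−s}/(s−1) − Σ_{n=0}^∞ C_{n+1} Σ_{k=0}^n (−1)^k C(n,k) (k+v)^{−s}`. -/
theorem hurwitz_cauchy_series (s v : ℂ) (hs : 1 < s.re) (hv : 1 < v.re) :
    ∃ L : ℂ,
      Tendsto (fun N : ℕ => ∑ n ∈ Finset.range N, (Complex.ofReal (cauchyC (n + 1))) *
          ∑ k ∈ Finset.range (n + 1), (-1) ^ k * (n.choose k : ℂ) * ((k : ℂ) + v) ^ (-s))
        atTop (nhds L) ∧
      (∑' n : ℕ, ((n : ℂ) + v) ^ (-s)) = (v - 1) ^ (1 - s) / (s - 1) - L := by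
  have hG : Complex.Gamma s ≠ 0 := Complex.Gamma_ne_zero_of_re_pos (zero_lt_one.trans hs)
  have hz (t : ℝ) (ht : 0 < t) : 0 < 1 - Real.exp (-t) := by simpa using ht
  obtain ⟨hgeom_int, hgeom⟩ := hasSum_integral_of_le_exp_div hs hv
    (f := fun n t => Real.exp (-t) ^ n) (F := fun t => (1 - Real.exp (-t))⁻¹)
    (fun n => by fun_prop) (by fun_prop) (fun n t _ => by positivity)
    (fun t ht => hasSum_geometric_of_lt_one (Real.exp_pos _).le (by simpa using ht))
    (fun t ht => inv_one_sub_exp_neg_le ht)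
  obtain ⟨hcauchy_int, hcauchy⟩ := hasSum_integral_of_le_exp_div hs hv
    (f := fun n t => cauchyC (n + 1) * (1 - Real.exp (-t)) ^ n)
    (F := fun t => Real.exp t / t - (1 - Real.exp (-t))⁻¹)
    (fun n => by fun_prop) (by fun_prop)
    (fun n t ht => mul_nonneg (cauchyC_nonneg _) (pow_nonneg (hz t ht).le n))
    (fun t ht => hasSum_cauchyC_succ_mul_pow ht)
    (fun t ht => sub_le_self _ (inv_nonneg.mpr (hz t ht).le))
  simp_rw [integral_mul_exp_neg_nat_mul hs hv] at hgeom
  simp_rw [integral_mul_one_sub_exp_neg_pow hs hv] at hcauchy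
  have hadd := MeasureTheory.integral_add hgeom_int hcauchy_int
  simp_rw [← mul_add, ← Complex.ofReal_add, add_sub_cancel, integral_mul_exp_div hs hv] at hadd
  have hcauchy' := hcauchy.div_const (Complex.Gamma s)
  have hgeom' := hgeom.div_const (Complex.Gamma s)
  simp_rw [mul_div_cancel_right₀ _ hG] at hcauchy' hgeom'
  refine ⟨_, hcauchy'.tendsto_sum_nat, ?_⟩
  rw [hgeom'.tsum_eq, eq_sub_iff_add_eq, ← add_div, ← hadd, mul_div_cancel_right₀ _ hG]
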